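/- arXiv:2403.15258 — 6 statements merged into one kernel-verified Lean document; each statement's English description precedes it below -/
import Mathlib

section
/- Let X1 and X2 be real random variables with distribution functions F1 and F2, finite second moments E X1² < ∞ and E X2² < ∞, and equal means E X1 = E X2. Then the integrated distribution functions s_j(t) = ∫_{−∞}^t F_j(x) dx satisfy s1 − s2 ∈ L¹(ℝ) and ∫_ℝ |s1(t) − s2(t)| dt ≤ (E X1² + E X2²)/2. -/
open MeasureTheory Filter Topology

/-- The integral of the distribution function up to `t` is the expected shortfall `E (t - X)⁺`. -/
theorem integral_Iic_measureReal_le {Ω : Type*} [MeasurableSpace Ω] {P : Measure Ω}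
    [IsProbabilityMeasure P] {X : Ω → ℝ} (hX : Integrable X P) (t : ℝ) :
    ∫ x in Set.Iic t, P.real {ω | X ω ≤ x} = ∫ ω, max (t - X ω) 0 ∂P := by
  have hint : Integrable (fun ω => max (t - X ω) 0) P := ((integrable_const t).sub hX).pos_part
  rw [hint.integral_eq_integral_meas_le (Eventually.of_forall fun ω => le_max_right _ _),
    integral_Iic_eq_integral_Iio, ← integral_indicator measurableSet_Iio,
    ← integral_indicator measurableSet_Ioi,
    ← integral_sub_left_eq_self _ volume t]
  congr 1
  ext u
  by_cases hu : 0 < u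
  · rw [Set.indicator_of_mem (show t - u ∈ Set.Iio t by simpa using hu),
      Set.indicator_of_mem (show u ∈ Set.Ioi 0 from hu)]
    congr 1
    ext ω
    simp only [Set.mem_ofPred_eq, le_max_iff, not_le.mpr hu, or_false]
    constructor <;> intro h <;> linarith
  · rw [Set.indicator_of_notMem (show t - u ∉ Set.Iio t by simpa using hu),
      Set.indicator_of_notMem (show u ∉ Set.Ioi 0 from hu)]

/-- The shortfall `(t - x)⁺` for `t ≤ 0`, replaced by the excess `(x - t)⁺` for `0 < t`. -/
noncomputable def tailGap (x t : ℝ) : ℝ := if t ≤ 0 then max (t - x) 0 else max (x - t) 0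

theorem tailGap_nonneg (x t : ℝ) : 0 ≤ tailGap x t := by
  unfold tailGap; split_ifs <;> exact le_max_right _ _

theorem measurable_tailGap : Measurable (Function.uncurry tailGap) := by
  unfold tailGap Function.uncurry
  exact Measurable.ite (measurableSet_le measurable_snd measurable_const)
    (by fun_prop) (by fun_prop)

theorem tailGap_of_nonneg {x : ℝ} (hx : 0 ≤ x) :
    tailGap x = (Set.Ioc 0 x).indicator fun t => x - t := by
  ext t
  simp only [tailGap, Set.indicator_apply, Set.mem_Ioc]
  grind

theorem tailGap_of_nonpos {x : ℝ} (hx : x ≤ 0) :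
    tailGap x = (Set.Ioc x 0).indicator fun t => t - x := by
  ext t
  simp only [tailGap, Set.indicator_apply, Set.mem_Ioc]
  grind

theorem integrable_tailGap (x : ℝ) : Integrable (tailGap x) := by
  rcases le_total 0 x with hx | hx
  · rw [tailGap_of_nonneg hx, integrable_indicator_iff measurableSet_Ioc]
    exact (by fun_prop : Continuous fun t : ℝ => x - t).integrableOn_Ioc
  · rw [tailGap_of_nonpos hx, integrable_indicator_iff measurableSet_Ioc]
    exact (by fun_prop : Continuous fun t : ℝ => t - x).integrableOn_Ioc

theorem integral_tailGap (x : ℝ) : ∫ t, tailGap x t = x ^ 2 / 2 := by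
  rcases le_total 0 x with hx | hx
  · rw [tailGap_of_nonneg hx, integral_indicator measurableSet_Ioc,
      ← intervalIntegral.integral_of_le hx, intervalIntegral.integral_sub (by simp) (by simp)]
    simp
    ring
  · rw [tailGap_of_nonpos hx, integral_indicator measurableSet_Ioc,
      ← intervalIntegral.integral_of_le hx, intervalIntegral.integral_sub (by simp) (by simp)]
    simp
    ring

section

variable {Ω : Type*} [MeasurableSpace Ω] {P : Measure Ω} {X : Ω → ℝ}

theorem integrable_prod_tailGap (hm : Measurable X) (h : Integrable (fun ω => X ω ^ 2) P) :
    Integrable (Function.uncurry fun ω t => tailGap (X ω) t) (P.prod volume) := by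
  have hmeas : Measurable (Function.uncurry fun ω t => tailGap (X ω) t) :=
    measurable_tailGap.comp ((hm.comp measurable_fst).prodMk measurable_snd)
  refine (integrable_prod_iff hmeas.aestronglyMeasurable).2
    ⟨Eventually.of_forall fun ω => integrable_tailGap (X ω), ?_⟩
  simpa [Real.norm_of_nonneg (tailGap_nonneg _ _), integral_tailGap] using h.div_const 2

variable [IsProbabilityMeasure P]

theorem integrable_integral_tailGap (hm : Measurable X) (h : Integrable (fun ω => X ω ^ 2) P) :
    Integrable fun t => ∫ ω, tailGap (X ω) t ∂P :=
  (integrable_prod_tailGap hm h).integral_prod_right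

theorem integral_integral_tailGap (hm : Measurable X) (h : Integrable (fun ω => X ω ^ 2) P) :
    ∫ t, ∫ ω, tailGap (X ω) t ∂P = (∫ ω, X ω ^ 2 ∂P) / 2 := by
  rw [← integral_integral_swap (integrable_prod_tailGap hm h)]
  simp [integral_tailGap, integral_div]

theorem integral_tailGap_eq (hX : Integrable X P) (t : ℝ) :
    ∫ ω, tailGap (X ω) t ∂P =
      (∫ ω, max (t - X ω) 0 ∂P) - if t ≤ 0 then 0 else t - ∫ ω, X ω ∂P := by
  have hint : Integrable (fun ω => t - X ω) P := (integrable_const t).sub hX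
  split_ifs with ht
  · simp [tailGap, ht]
  · have hsub : ∫ ω, (t - X ω) ∂P = t - ∫ ω, X ω ∂P := by
      rw [integral_sub (integrable_const t) hX]; simp
    rw [← hsub, ← integral_sub hint.pos_part hint]
    congr 1
    ext ω
    simp only [tailGap, ht, if_false]
    grind

end

/-- **Integrability of the difference of integrated distribution functions.**
If `X1, X2` have finite second moments and equal means, then the integrated distribution
functions `s_j(t) = ∫_{-∞}^t F_j` satisfy `s1 - s2 ∈ L¹(ℝ)` and
`∫ |s1 - s2| ≤ (E X1² + E X2²) / 2`. -/
theorem integrated_cdf_diff_integrable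
    {Ω : Type*} [MeasurableSpace Ω] (P : Measure Ω) [IsProbabilityMeasure P]
    (X1 X2 : Ω → ℝ) (hm1 : Measurable X1) (hm2 : Measurable X2)
    (h1 : Integrable (fun ω => (X1 ω) ^ 2) P) (h2 : Integrable (fun ω => (X2 ω) ^ 2) P)
    (hmean : ∫ ω, X1 ω ∂P = ∫ ω, X2 ω ∂P)
    (F1 F2 s1 s2 : ℝ → ℝ)
    (hF1 : ∀ t, F1 t = (P {ω | X1 ω ≤ t}).toReal)
    (hF2 : ∀ t, F2 t = (P {ω | X2 ω ≤ t}).toReal)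
    (hs1 : ∀ t, s1 t = ∫ x in Set.Iic t, F1 x)
    (hs2 : ∀ t, s2 t = ∫ x in Set.Iic t, F2 x) :
    Integrable (fun t => s1 t - s2 t) (volume : Measure ℝ) ∧
      ∫ t, |s1 t - s2 t| ≤ ((∫ ω, (X1 ω) ^ 2 ∂P) + ∫ ω, (X2 ω) ^ 2 ∂P) / 2 := by
  have hX1 : Integrable X1 P :=
    ((memLp_two_iff_integrable_sq hm1.aestronglyMeasurable).2 h1).integrable one_le_two
  have hX2 : Integrable X2 P :=
    ((memLp_two_iff_integrable_sq hm2.aestronglyMeasurable).2 h2).integrable one_le_two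
  have key : ∀ t, s1 t - s2 t = (∫ ω, tailGap (X1 ω) t ∂P) - ∫ ω, tailGap (X2 ω) t ∂P := by
    intro t
    rw [integral_tailGap_eq hX1, integral_tailGap_eq hX2, hmean, hs1, hs2, funext hF1, funext hF2,
      ← integral_Iic_measureReal_le hX1, ← integral_Iic_measureReal_le hX2, sub_sub_sub_cancel_right]
    rfl
  have hi1 := integrable_integral_tailGap hm1 h1
  have hi2 := integrable_integral_tailGap hm2 h2
  simp only [key]
  refine ⟨hi1.sub hi2, ?_⟩
  calc ∫ t, |(∫ ω, tailGap (X1 ω) t ∂P) - ∫ ω, tailGap (X2 ω) t ∂P|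
      ≤ ∫ t, ((∫ ω, tailGap (X1 ω) t ∂P) + ∫ ω, tailGap (X2 ω) t ∂P) := by
        refine integral_mono (hi1.sub hi2).abs (hi1.add hi2) fun t => ?_
        have hn1 : 0 ≤ ∫ ω, tailGap (X1 ω) t ∂P := integral_nonneg fun _ => tailGap_nonneg _ _
        have hn2 : 0 ≤ ∫ ω, tailGap (X2 ω) t ∂P := integral_nonneg fun _ => tailGap_nonneg _ _
        exact abs_le.2 ⟨by linarith, by linarith⟩
    _ = ((∫ ω, (X1 ω) ^ 2 ∂P) + ∫ ω, (X2 ω) ^ 2 ∂P) / 2 := by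
        rw [integral_add hi1 hi2, integral_integral_tailGap hm1 h1,
          integral_integral_tailGap hm2 h2, add_div]
end

section
/- Let D ⊆ ℝ be an interval and s1, s2 : D → ℝ measurable with s1 − s2 Lebesgue-integrable on D, and let 0 ≤ ε < 1/2. Then ∫_{{s1<s2}} (s2−s1) dt ≤ ε·∫_D |s1−s2| dt if and only if (1−2ε)·∫_D |s1−s2| dt ≤ ∫_D (s1−s2) dt; that is, X1 ≼_s^ε X2 holds if and only if the 2DSD index I(s1,s2) lies in the region R_{1,ε} = { (x,y) ∈ Δ : y ≤ x/(1−2ε) }, where Δ = { (x,y) : |x| ≤ y }. -/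
open MeasureTheory Filter Topology

/-- The integral of `g - f` over `{f < g}` is half the difference between the integrals of
`|f - g|` and `f - g`. -/
theorem setIntegral_inter_lt_sub {α : Type*} [MeasurableSpace α] {μ : Measure α} {D : Set α}
    {f g : α → ℝ} (hf : Measurable f) (hg : Measurable g)
    (hfg : IntegrableOn (fun t => f t - g t) D μ) :
    ∫ t in D ∩ {t | f t < g t}, (g t - f t) ∂μ =
      ((∫ t in D, |f t - g t| ∂μ) - ∫ t in D, (f t - g t) ∂μ) / 2 := by
  rw [← setIntegral_indicator (measurableSet_lt hf hg), ← integral_sub hfg.abs hfg,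
    ← integral_div]
  congr 1
  funext t
  by_cases h : f t < g t
  · rw [Set.indicator_of_mem (show t ∈ {t | f t < g t} from h), abs_of_neg (sub_neg.2 h)]
    ring
  · rw [Set.indicator_of_notMem (show t ∉ {t | f t < g t} from h),
      abs_of_nonneg (sub_nonneg.2 (not_lt.1 h))]
    ring

/-- **Characterization of ε-almost s-stochastic dominance through the 2DSD index.**
For `0 ≤ ε < 1/2`, the almost dominance `X1 ≼ₛ^ε X2`, i.e.
`∫_{s1<s2} (s2-s1) ≤ ε ∫_D |s1-s2|`, holds iff the 2DSD index
`(∫_D (s1-s2), ∫_D |s1-s2|)` lies in the region `R_{1,ε} = {(x,y) ∈ Δ : y ≤ x/(1-2ε)}`,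
i.e. iff `(1-2ε) ∫_D |s1-s2| ≤ ∫_D (s1-s2)`. -/
theorem twoDSD_index_characterizes_ASD
    (D : Set ℝ) (hD : MeasurableSet D) (hDconn : D.OrdConnected)
    (s1 s2 : ℝ → ℝ) (hm1 : Measurable s1) (hm2 : Measurable s2)
    (hInt : IntegrableOn (fun t => s1 t - s2 t) D)
    (ε : ℝ) (hε0 : 0 ≤ ε) (hε : ε < 1 / 2) :
    (∫ t in D ∩ {t | s1 t < s2 t}, (s2 t - s1 t) ≤ ε * ∫ t in D, |s1 t - s2 t|) ↔
      (1 - 2 * ε) * ∫ t in D, |s1 t - s2 t| ≤ ∫ t in D, (s1 t - s2 t) := by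
  rw [setIntegral_inter_lt_sub hm1 hm2 hInt]
  constructor <;> intro h <;> linarith
end

section
/- Let D ⊆ ℝ be an interval, θ := s1 − s2 ∈ L¹(D), (T_n) L¹(D)-valued random elements and r_n → ∞ with r_n (T_n − θ) converging in distribution in L¹(D) to a centered Gaussian L¹(D)-valued random element S. Then the following are equivalent: (a) the limit in distribution of r_n·( (∫_D T_n, ∫_D |T_n|) − (∫_D θ, ∫_D |θ|) ) is bivariate normal; (b) S·1_{{θ=0}} = 0 Lebesgue-almost everywhere on D, almost surely; (c) this limit equals ( ∫_D S dt , ∫_D S·sgn(θ) dt ). In particular, if the contact set {t ∈ D : s1(t) = s2(t)} has Lebesgue measure zero, then (a), (b) and (c) hold. -/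
open MeasureTheory Filter Topology BoundedContinuousFunction ProbabilityTheory

/-- A random variable dominating `Y`, `Y + Z` and `Y - Z` for centered Gaussian variables can only
be Gaussian if `Z` vanishes almost surely. -/
lemma ae_eq_zero_of_gaussian_dominating {Ω : Type*} [MeasurableSpace Ω] {P : Measure Ω}
    {U Y Z : Ω → ℝ} {m : ℝ} {v v₀ v₁ v₂ v₃ : NNReal}
    (hU : P.map U = gaussianReal m v) (hY : P.map Y = gaussianReal 0 v₀)
    (hadd : P.map (fun ω => Y ω + Z ω) = gaussianReal 0 v₁)
    (hsub : P.map (fun ω => Y ω - Z ω) = gaussianReal 0 v₂)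
    (hZ : P.map Z = gaussianReal 0 v₃)
    (h₀ : ∀ ω, Y ω ≤ U ω) (h₁ : ∀ ω, Y ω + Z ω ≤ U ω) (h₂ : ∀ ω, Y ω - Z ω ≤ U ω) :
    ∀ᵐ ω ∂P, Z ω = 0 := by
  have law {X : Ω → ℝ} {m : ℝ} {v : NNReal} (h : P.map X = gaussianReal m v) :
      HasLaw X (gaussianReal m v) P :=
    ⟨aemeasurable_of_map_neZero (by rw [h]; infer_instance), h⟩
  have exp_int {X : Ω → ℝ} {m : ℝ} {v : NNReal} (h : P.map X = gaussianReal m v) (t : ℝ) :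
      Integrable (fun ω => Real.exp (t * X ω)) P := by
    have := integrable_exp_mul_gaussianReal (μ := m) (v := v) t
    rw [← h] at this
    exact this.comp_aemeasurable (law h).aemeasurable
  have memLp {X : Ω → ℝ} {m : ℝ} {v : NNReal} (h : P.map X = gaussianReal m v) :
      MemLp X 2 P := by
    have := memLp_id_gaussianReal' (μ := m) (v := v) 2 (by simp)
    rw [← h] at this
    exact this.comp_of_map (law h).aemeasurable
  have second_moment {X : Ω → ℝ} {v : NNReal} (h : P.map X = gaussianReal 0 v) :
      ∫ ω, X ω ^ 2 ∂P = v := by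
    rw [← variance_of_integral_eq_zero (law h).aemeasurable, (law h).variance_eq,
      variance_id_gaussianReal]
    rw [(law h).integral_eq, integral_id_gaussianReal]
  have upper {X : Ω → ℝ} {w : NNReal} (h : P.map X = gaussianReal 0 w) (hle : ∀ ω, X ω ≤ U ω)
      {t : ℝ} (ht : 0 < t) : w * t ^ 2 / 2 ≤ m * t + v * t ^ 2 / 2 := by
    have : mgf X P t ≤ mgf U P t := integral_mono (exp_int h t) (exp_int hU t) fun ω =>
      Real.exp_le_exp.2 (mul_le_mul_of_nonneg_left (hle ω) ht.le)
    rw [mgf_gaussianReal h, mgf_gaussianReal hU] at this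
    simpa using this
  have lower {t : ℝ} (ht : 0 < t) : -(m * t) + v * t ^ 2 / 2 ≤ v₀ * t ^ 2 / 2 := by
    have : mgf U P (-t) ≤ mgf Y P (-t) := integral_mono (exp_int hU _) (exp_int hY _) fun ω =>
      Real.exp_le_exp.2 (mul_le_mul_of_nonpos_left (h₀ ω) (by linarith))
    rw [mgf_gaussianReal hY, mgf_gaussianReal hU] at this
    simpa using this
  have parallelogram : (v₁ : ℝ) + v₂ = 2 * v₀ + 2 * v₃ := by
    rw [← second_moment hadd, ← second_moment hsub, ← second_moment hY, ← second_moment hZ,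
      ← integral_add (memLp hadd).integrable_sq (memLp hsub).integrable_sq,
      ← integral_const_mul, ← integral_const_mul,
      ← integral_add ((memLp hY).integrable_sq.const_mul 2) ((memLp hZ).integrable_sq.const_mul 2)]
    congr 1
    ext ω
    ring
  have hv₃ : v₃ = 0 := by
    by_contra hne
    have hpos : (0 : ℝ) < v₃ := by exact_mod_cast pos_iff_ne_zero.2 hne
    have bound {t : ℝ} (ht : 0 < t) : v₃ * t ≤ 4 * m := by
      have hu₁ := upper hadd h₁ ht
      have hu₂ := upper hsub h₂ ht
      have hl := lower ht
      refine le_of_mul_le_mul_right ?_ ht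
      nlinarith
    have ht : (0 : ℝ) < (4 * |m| + 1) / v₃ := by positivity
    have := bound ht
    rw [mul_div_cancel₀ _ hpos.ne'] at this
    linarith [le_abs_self m]
  rw [hv₃, gaussianReal_zero_var] at hZ
  exact (HasLaw.ae_eq_of_dirac ⟨(aemeasurable_of_map_neZero (by rw [hZ]; infer_instance)), hZ⟩)

/-- Integration against a bounded measurable function is a continuous linear functional
on `L¹`. -/
lemma exists_continuousLinearMap_integral_mul {α : Type*} [MeasurableSpace α] (μ : Measure α)
    {h : α → ℝ} (hm : Measurable h) {C : ℝ} (hC : ∀ x, |h x| ≤ C) :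
    ∃ φ : Lp ℝ 1 μ →L[ℝ] ℝ, ∀ f : Lp ℝ 1 μ, φ f = ∫ x, f x * h x ∂μ := by
  have int (f : Lp ℝ 1 μ) : Integrable (fun x => f x * h x) μ :=
    (L1.integrable_coeFn f).mul_bdd hm.aestronglyMeasurable (ae_of_all _ hC)
  refine ⟨LinearMap.mkContinuous
    { toFun := fun f => ∫ x, f x * h x ∂μ
      map_add' := fun f g => ?_
      map_smul' := fun c f => ?_ } C fun f => ?_, fun f => rfl⟩
  · rw [← integral_add (int f) (int g)]
    refine integral_congr_ae ?_
    filter_upwards [Lp.coeFn_add f g] with x hx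
    rw [hx, Pi.add_apply, add_mul]
  · rw [RingHom.id_apply, smul_eq_mul, ← integral_const_mul]
    refine integral_congr_ae ?_
    filter_upwards [Lp.coeFn_smul c f] with x hx
    rw [hx, Pi.smul_apply, smul_eq_mul, mul_assoc]
  · rw [LinearMap.coe_mk, AddHom.coe_mk, L1.norm_eq_integral_norm, ← integral_const_mul]
    refine norm_integral_le_of_norm_le ((L1.integrable_coeFn f).norm.const_mul C)
      (ae_of_all _ fun x => ?_)
    rw [norm_mul, mul_comm]
    exact mul_le_mul_of_nonneg_right (hC x) (norm_nonneg _)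

/-- An integrable function on `ℝ` whose integrals over all half-lines with rational endpoint
vanish is zero almost everywhere. -/
lemma ae_eq_zero_of_forall_setIntegral_Iic_rat {μ : Measure ℝ} {f : ℝ → ℝ} (hf : Integrable f μ)
    (h : ∀ q : ℚ, ∫ x in Set.Iic (q : ℝ), f x ∂μ = 0) : f =ᵐ[μ] 0 := by
  have huniv : ∫ x, f x ∂μ = 0 := by
    have hmono : Monotone fun n : ℕ => Set.Iic (((n : ℚ) : ℝ)) := fun a b hab =>
      Set.Iic_subset_Iic.2 (by exact_mod_cast hab)
    have hlim := tendsto_setIntegral_of_monotone (μ := μ) (f := f)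
      (fun n : ℕ => measurableSet_Iic) hmono hf.integrableOn
    have hUnion : ⋃ n : ℕ, Set.Iic (((n : ℚ) : ℝ)) = Set.univ :=
      Set.eq_univ_of_forall fun x => Set.mem_iUnion.2 <| by
        obtain ⟨n, hn⟩ := exists_nat_ge x
        exact ⟨n, by simpa using hn⟩
    simp only [h, hUnion, Measure.restrict_univ] at hlim
    exact tendsto_nhds_unique hlim tendsto_const_nhds
  refine hf.ae_eq_zero_of_forall_setIntegral_eq_zero fun s hs _ => ?_
  clear * - hf h huniv hs
  induction s, hs using MeasurableSpace.induction_on_inter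
    ((BorelSpace.measurable_eq (α := ℝ)).trans Real.borel_eq_generateFrom_Iic_rat)
    Real.isPiSystem_Iic_rat with
  | empty => simp
  | basic t ht =>
    obtain ⟨q, rfl⟩ := Set.mem_iUnion.1 ht
    exact h q
  | compl t htm ih =>
    have := integral_add_compl htm hf
    rw [huniv] at this
    linarith
  | iUnion g hd hg ih =>
    rw [integral_iUnion hg hd hf.integrableOn]
    simp [ih]

/-- **Normality of the limit distribution of the 2DSD index.**
Suppose `r_n (T_n - θ) ⇝ S` in `L¹(D)` with `θ = s1 - s2` and `S` a centered Gaussian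
`L¹(D)`-valued random element.  Let `W = (∫_D S, ∫_{θ=0} |S| + ∫_{θ≠0} S·sgn θ)` be the limit
of the normalized 2DSD statistic and `W' = (∫_D S, ∫_D S·sgn θ)`.  The following are
equivalent: (a) `W` is bivariate normal; (b) `S·1_{θ=0} = 0` a.e. on `D`, almost surely;
(c) `W` has the same law as `W'`.  In particular, all three hold if the contact set
`{s1 = s2}` has Lebesgue measure zero. -/
theorem twoDSD_index_limit_normality_characterization
    {Ω : Type*} [MeasurableSpace Ω] (P : Measure Ω) [IsProbabilityMeasure P]
    (D : Set ℝ) (hD : MeasurableSet D) (hDconn : D.OrdConnected)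
    (s1 s2 : ℝ → ℝ) (hm1 : Measurable s1) (hm2 : Measurable s2)
    (hθ : Integrable (fun t => s1 t - s2 t) (volume.restrict D))
    (T : ℕ → Ω → Lp ℝ 1 (volume.restrict D))
    (S : Ω → Lp ℝ 1 (volume.restrict D))
    (r : ℕ → ℝ) (hrpos : ∀ n, 0 < r n) (hr : Tendsto r atTop atTop)
    (hconv : ∀ f : (Lp ℝ 1 (volume.restrict D)) →ᵇ ℝ,
      Tendsto (fun n => ∫ ω, f (r n • (T n ω - Integrable.toL1 _ hθ)) ∂P) atTop
        (𝓝 (∫ ω, f (S ω) ∂P)))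
    -- `S` is a centered Gaussian random element of `L¹(D)`: every continuous linear
    -- functional of `S` is a centered (possibly degenerate) Gaussian real variable
    (hGauss : ∀ φ : (Lp ℝ 1 (volume.restrict D)) →L[ℝ] ℝ, ∃ v : NNReal,
      P.map (fun ω => φ (S ω)) = gaussianReal 0 v)
    -- the limit random vector of the normalized 2DSD index and its candidate normal form
    (W W' : Ω → ℝ × ℝ) (hWmeas : Measurable W) (hW'meas : Measurable W')
    (hW : ∀ ω, W ω = ((∫ t, (S ω : ℝ → ℝ) t ∂(volume.restrict D)),
      (∫ t in {t | s1 t = s2 t}, |(S ω : ℝ → ℝ) t| ∂(volume.restrict D)) +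
        ∫ t in {t | s1 t ≠ s2 t},
          (S ω : ℝ → ℝ) t * Real.sign (s1 t - s2 t) ∂(volume.restrict D)))
    (hW' : ∀ ω, W' ω = ((∫ t, (S ω : ℝ → ℝ) t ∂(volume.restrict D)),
      ∫ t, (S ω : ℝ → ℝ) t * Real.sign (s1 t - s2 t) ∂(volume.restrict D))) :
    -- (a) ↔ (b), (b) ↔ (c), and the "in particular" statement
    (((∀ a b : ℝ, ∃ (m : ℝ) (v : NNReal),
        P.map (fun ω => a * (W ω).1 + b * (W ω).2) = gaussianReal m v) ↔
      (∀ᵐ ω ∂P, ∀ᵐ t ∂(volume.restrict D), s1 t = s2 t → (S ω : ℝ → ℝ) t = 0)) ∧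
    ((∀ᵐ ω ∂P, ∀ᵐ t ∂(volume.restrict D), s1 t = s2 t → (S ω : ℝ → ℝ) t = 0) ↔
      P.map W = P.map W')) ∧
    ((volume.restrict D) {t | s1 t = s2 t} = 0 →
      ((∀ a b : ℝ, ∃ (m : ℝ) (v : NNReal),
          P.map (fun ω => a * (W ω).1 + b * (W ω).2) = gaussianReal m v) ∧
        (∀ᵐ ω ∂P, ∀ᵐ t ∂(volume.restrict D), s1 t = s2 t → (S ω : ℝ → ℝ) t = 0) ∧
        P.map W = P.map W')) := by
  clear hrpos hr hconv T hθ
  revert S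
  generalize volume.restrict D = μ
  intro S hGauss hW hW'
  set A : Set ℝ := {t | s1 t = s2 t} with hA_def
  have hA : MeasurableSet A := measurableSet_eq_fun hm1 hm2
  set g : ℝ → ℝ := fun t => Real.sign (s1 t - s2 t) with hg_def
  have hg : Measurable g := by
    have hsign : Measurable Real.sign :=
      Measurable.ite measurableSet_Iio measurable_const
        (Measurable.ite measurableSet_Ioi measurable_const measurable_const)
    exact hsign.comp (hm1.sub hm2)
  have hg_le (t : ℝ) : |g t| ≤ 1 := by
    rcases Real.sign_apply_eq (s1 t - s2 t) with h | h | h <;> simp [hg_def, h]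
  have hg_zero {t : ℝ} (ht : t ∈ A) : g t = 0 := by
    have : s1 t = s2 t := ht
    simp [hg_def, this]
  have hint (ω : Ω) : Integrable (S ω : ℝ → ℝ) μ := L1.integrable_coeFn _
  have hgauss {h : ℝ → ℝ} (hm : Measurable h) {C : ℝ} (hC : ∀ t, |h t| ≤ C) :
      ∃ v : NNReal, P.map (fun ω => ∫ t, (S ω : ℝ → ℝ) t * h t ∂μ) = gaussianReal 0 v := by
    obtain ⟨φ, hφ⟩ := exists_continuousLinearMap_integral_mul μ hm hC
    simpa only [hφ] using hGauss φ
  have hfst (ω : Ω) : (W ω).1 = (W' ω).1 := by rw [hW, hW']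
  have hsnd (ω : Ω) : (W ω).2 = (∫ t in A, |(S ω : ℝ → ℝ) t| ∂μ) + (W' ω).2 := by
    rw [hW, hW']
    refine congrArg (_ + ·) ?_
    refine setIntegral_eq_integral_of_forall_compl_eq_zero fun t ht => ?_
    rw [show Real.sign (s1 t - s2 t) = 0 from hg_zero (not_not.1 ht), mul_zero]
  have hW'gauss (a b : ℝ) :
      ∃ v : NNReal, P.map (fun ω => a * (W' ω).1 + b * (W' ω).2) = gaussianReal 0 v := by
    obtain ⟨v, hv⟩ := hgauss (h := fun t => a + b * g t) (C := |a| + |b|) (by fun_prop)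
      fun t => (abs_add_le _ _).trans <| by
        rw [abs_mul]
        gcongr
        exact mul_le_of_le_one_right (abs_nonneg b) (hg_le t)
    refine ⟨v, hv ▸ congrArg (P.map ·) (funext fun ω => ?_)⟩
    rw [hW', ← integral_const_mul, ← integral_const_mul, ← integral_add]
    · congr 1
      ext t
      simp only [hg_def]
      ring
    · exact (hint ω).const_mul a
    · exact ((hint ω).mul_bdd hg.aestronglyMeasurable (ae_of_all _ hg_le)).const_mul b
  have normal_imp : (∀ a b : ℝ, ∃ (m : ℝ) (v : NNReal),
        P.map (fun ω => a * (W ω).1 + b * (W ω).2) = gaussianReal m v) →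
      ∀ᵐ ω ∂P, ∀ᵐ t ∂μ, s1 t = s2 t → (S ω : ℝ → ℝ) t = 0 := by
    intro hnormal
    obtain ⟨m, v, hU⟩ := hnormal 0 1
    obtain ⟨v₀, hY⟩ := hW'gauss 0 1
    simp only [zero_mul, one_mul, zero_add] at hU hY
    have hZ (q : ℚ) : ∀ᵐ ω ∂P, ∫ t in Set.Iic (q : ℝ), A.indicator (S ω : ℝ → ℝ) t ∂μ = 0 := by
      set k : ℝ → ℝ := (Set.Iic (q : ℝ) ∩ A).indicator 1 with hk_def
      have hk : Measurable k := measurable_one.indicator (measurableSet_Iic.inter hA)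
      have hk_le (t : ℝ) : |k t| ≤ 1 := by
        by_cases ht : t ∈ Set.Iic (q : ℝ) ∩ A <;> simp [hk_def, ht]
      have hZ_eq (ω : Ω) : ∫ t in Set.Iic (q : ℝ), A.indicator (S ω : ℝ → ℝ) t ∂μ
          = ∫ t, (S ω : ℝ → ℝ) t * k t ∂μ := by
        rw [← integral_indicator measurableSet_Iic, Set.indicator_indicator]
        congr 1
        ext t
        by_cases ht : t ∈ Set.Iic (q : ℝ) ∩ A <;> simp [hk_def, ht]
      have hZ_le (ω : Ω) :
          |∫ t, (S ω : ℝ → ℝ) t * k t ∂μ| ≤ ∫ t in A, |(S ω : ℝ → ℝ) t| ∂μ := by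
        rw [← integral_indicator hA, ← Real.norm_eq_abs]
        refine norm_integral_le_of_norm_le ((hint ω).abs.indicator hA) (ae_of_all _ fun t => ?_)
        by_cases ht : t ∈ A
        · rw [Set.indicator_of_mem ht, norm_mul]
          exact mul_le_of_le_one_right (abs_nonneg _) (hk_le t)
        · simp [hk_def, ht]
      have hk_int (ω : Ω) : Integrable (fun t => (S ω : ℝ → ℝ) t * k t) μ :=
        (hint ω).mul_bdd hk.aestronglyMeasurable (ae_of_all _ hk_le)
      have hg_int (ω : Ω) : Integrable (fun t => (S ω : ℝ → ℝ) t * g t) μ :=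
        (hint ω).mul_bdd hg.aestronglyMeasurable (ae_of_all _ hg_le)
      obtain ⟨v₁, hadd⟩ := hgauss (h := fun t => g t + k t) (C := 1 + 1) (by fun_prop)
        fun t => (abs_add_le _ _).trans (add_le_add (hg_le t) (hk_le t))
      obtain ⟨v₂, hsub⟩ := hgauss (h := fun t => g t - k t) (C := 1 + 1) (by fun_prop)
        fun t => (abs_sub _ _).trans (add_le_add (hg_le t) (hk_le t))
      obtain ⟨v₃, hZ⟩ := hgauss hk hk_le
      simp only [hZ_eq]
      simp only [mul_add, mul_sub, integral_add (hg_int _) (hk_int _),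
        integral_sub (hg_int _) (hk_int _)] at hadd hsub
      have hY_eq (ω : Ω) : (W' ω).2 = ∫ t, (S ω : ℝ → ℝ) t * g t ∂μ := by rw [hW']
      simp only [← hY_eq] at hadd hsub
      refine ae_eq_zero_of_gaussian_dominating hU hY hadd hsub hZ ?_ ?_ ?_ <;>
      · intro ω
        have := abs_le.1 (hZ_le ω)
        have := abs_nonneg (∫ t, (S ω : ℝ → ℝ) t * k t ∂μ)
        linarith [hsnd ω, hZ_le ω]
    filter_upwards [ae_all_iff.2 hZ] with ω hω
    filter_upwards [ae_eq_zero_of_forall_setIntegral_Iic_rat ((hint ω).indicator hA) hω]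
      with t ht hts
    rwa [Set.indicator_of_mem (show t ∈ A from hts)] at ht
  have ae_eq : (∀ᵐ ω ∂P, ∀ᵐ t ∂μ, s1 t = s2 t → (S ω : ℝ → ℝ) t = 0) → W =ᵐ[P] W' := by
    intro hzero
    filter_upwards [hzero] with ω hω
    refine Prod.ext (hfst ω) ?_
    have : ∫ t in A, |(S ω : ℝ → ℝ) t| ∂μ = 0 := by
      refine setIntegral_eq_zero_of_ae_eq_zero ?_
      filter_upwards [hω] with t ht hts
      rw [ht hts, abs_zero]
    rw [hsnd, this, zero_add]
  have imp_law (h : ∀ᵐ ω ∂P, ∀ᵐ t ∂μ, s1 t = s2 t → (S ω : ℝ → ℝ) t = 0) :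
      P.map W = P.map W' := Measure.map_congr (ae_eq h)
  have law_imp (hlaw : P.map W = P.map W') (a b : ℝ) : ∃ (m : ℝ) (v : NNReal),
      P.map (fun ω => a * (W ω).1 + b * (W ω).2) = gaussianReal m v := by
    have hL : Measurable fun p : ℝ × ℝ => a * p.1 + b * p.2 := by fun_prop
    obtain ⟨v, hv⟩ := hW'gauss a b
    refine ⟨0, v, ?_⟩
    rw [← hv]
    calc P.map (fun ω => a * (W ω).1 + b * (W ω).2)
        = (P.map W).map (fun p => a * p.1 + b * p.2) := (Measure.map_map hL hWmeas).symm
      _ = P.map (fun ω => a * (W' ω).1 + b * (W' ω).2) := by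
        rw [hlaw, Measure.map_map hL hW'meas]
        rfl
  refine ⟨⟨⟨normal_imp, fun h => law_imp (imp_law h)⟩,
    imp_law, fun h => normal_imp (law_imp h)⟩, fun hnull => ?_⟩
  have hzero : ∀ᵐ ω ∂P, ∀ᵐ t ∂μ, s1 t = s2 t → (S ω : ℝ → ℝ) t = 0 :=
    ae_of_all _ fun ω => (measure_eq_zero_iff_ae_notMem.1 hnull).mono fun t ht hts => (ht hts).elim
  exact ⟨law_imp (imp_law hzero), hzero, imp_law hzero⟩
end

section
/- Let (E, μ) be a σ-finite measure space and θ ∈ L¹(μ). Then the L¹-norm is Hadamard directionally differentiable at θ with derivative δ'_θ(h) = ∫_{{θ=0}} |h| dμ + ∫_{{θ≠0}} h·sgn(θ) dμ: for every h ∈ L¹(μ), every sequence (h_n) in L¹(μ) with ‖h_n − h‖_{L¹} → 0, and every sequence of positive reals t_n ↓ 0, one has ( ‖θ + t_n h_n‖_{L¹} − ‖θ‖_{L¹} ) / t_n → δ'_θ(h). -/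
open MeasureTheory Filter Topology

/-- The right difference quotient of the absolute value at `a` in direction `b` converges. -/
lemma tendsto_abs_add_mul_sub_div (a b : ℝ) :
    Tendsto (fun s : ℝ => (|a + s * b| - |a|) / s) (𝓝[>] 0)
      (𝓝 (if a = 0 then |b| else b * Real.sign a)) := by
  have hlim : Tendsto (fun s : ℝ => a + s * b) (𝓝[>] 0) (𝓝 a) := by
    have hc : Continuous fun s : ℝ => a + s * b := by fun_prop
    simpa using (hc.tendsto 0).mono_left nhdsWithin_le_nhds
  apply tendsto_const_nhds.congr'
  rcases lt_trichotomy a 0 with ha | rfl | ha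
  · filter_upwards [self_mem_nhdsWithin, hlim.eventually (gt_mem_nhds ha)] with s hs hs'
    have hs0 : s ≠ 0 := ne_of_gt hs
    rw [if_neg ha.ne, Real.sign_of_neg ha, abs_of_neg hs', abs_of_neg ha]
    field_simp
    ring
  · filter_upwards [self_mem_nhdsWithin] with s hs
    have hs0 : 0 < s := hs
    simp [abs_mul, abs_of_pos hs0, hs0.ne']
  · filter_upwards [self_mem_nhdsWithin, hlim.eventually (lt_mem_nhds ha)] with s hs hs'
    have hs0 : s ≠ 0 := ne_of_gt hs
    rw [if_neg ha.ne', Real.sign_of_pos ha, abs_of_pos hs', abs_of_pos ha]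
    field_simp
    ring

lemma abs_abs_add_mul_sub_abs_add_mul_div_le (a b c : ℝ) {s : ℝ} (hs : 0 < s) :
    |(|a + s * b| - |a + s * c|) / s| ≤ |b - c| := by
  rw [abs_div, abs_of_pos hs, div_le_iff₀ hs]
  calc |(|a + s * b| - |a + s * c|)| ≤ |(a + s * b) - (a + s * c)| := abs_abs_sub_abs_le_abs_sub _ _
    _ = |b - c| * s := by
      rw [add_sub_add_left_eq_sub, ← mul_sub, abs_mul, abs_of_pos hs, mul_comm]

/-- **Hadamard directional differentiability of the L¹-norm.**
For `θ ∈ L¹(μ)` on a σ-finite measure space, and any `h_n → h` in `L¹(μ)` and positive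
`t_n ↓ 0`, one has `(‖θ + t_n h_n‖₁ - ‖θ‖₁)/t_n → δ'_θ(h)`, where
`δ'_θ(h) = ∫_{θ=0} |h| dμ + ∫_{θ≠0} h·sgn(θ) dμ`. -/
theorem L1_norm_hadamard_directionally_differentiable
    {E : Type*} [MeasurableSpace E] (μ : Measure E) [SigmaFinite μ]
    (θ : E → ℝ) (hmθ : Measurable θ) (hθ : Integrable θ μ)
    (h : E → ℝ) (hmh : Measurable h) (hh : Integrable h μ)
    (hn : ℕ → E → ℝ) (hmhn : ∀ n, Measurable (hn n)) (hhn : ∀ n, Integrable (hn n) μ)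
    (hconv : Tendsto (fun n => ∫ x, |hn n x - h x| ∂μ) atTop (𝓝 0))
    (t : ℕ → ℝ) (htpos : ∀ n, 0 < t n) (htanti : Antitone t)
    (ht0 : Tendsto t atTop (𝓝 0)) :
    Tendsto (fun n => ((∫ x, |θ x + t n * hn n x| ∂μ) - ∫ x, |θ x| ∂μ) / t n) atTop
      (𝓝 ((∫ x in {x | θ x = 0}, |h x| ∂μ) +
        ∫ x in {x | θ x ≠ 0}, h x * Real.sign (θ x) ∂μ)) := by
  have hsub : Tendsto t atTop (𝓝[>] 0) :=
    tendsto_nhdsWithin_iff.2 ⟨ht0, Eventually.of_forall htpos⟩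
  have hint (n : ℕ) {k : E → ℝ} (hk : Integrable k μ) :
      Integrable (fun x => |θ x + t n * k x|) μ := (hθ.add (hk.const_mul (t n))).abs
  have hset : MeasurableSet {x | θ x = 0} := hmθ (measurableSet_singleton 0)
  have hsign : Measurable fun x => Real.sign (θ x) := by
    unfold Real.sign
    exact Measurable.ite (measurableSet_lt hmθ measurable_const) measurable_const
      (Measurable.ite (measurableSet_lt measurable_const hmθ) measurable_const measurable_const)
  have hhsign : Integrable (fun x => h x * Real.sign (θ x)) μ := by
    refine hh.mono (hmh.mul hsign).aestronglyMeasurable (Eventually.of_forall fun x => ?_)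
    rcases Real.sign_apply_eq (θ x) with hx | hx | hx <;> simp [hx]
  have hfixed : Tendsto (fun n => ∫ x, (|θ x + t n * h x| - |θ x|) / t n ∂μ) atTop
      (𝓝 ((∫ x in {x | θ x = 0}, |h x| ∂μ) +
        ∫ x in {x | θ x ≠ 0}, h x * Real.sign (θ x) ∂μ)) := by
    classical
    have hlim := integral_piecewise hset hh.abs.integrableOn hhsign.integrableOn
    change _ = _ + ∫ x in {x | θ x ≠ 0}, h x * Real.sign (θ x) ∂μ at hlim
    rw [← hlim]
    refine tendsto_integral_of_dominated_convergence (fun x => |h x|)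
      (fun n => (((hint n hh).sub hθ.abs).div_const _).aestronglyMeasurable) hh.abs
      (fun n => Eventually.of_forall fun x => ?_) (Eventually.of_forall fun x => ?_)
    · simpa [abs_div] using abs_abs_add_mul_sub_abs_add_mul_div_le (θ x) (h x) 0 (htpos n)
    · exact (tendsto_abs_add_mul_sub_div (θ x) (h x)).comp hsub
  have hdiff : Tendsto (fun n => ∫ x, (|θ x + t n * hn n x| - |θ x + t n * h x|) / t n ∂μ)
      atTop (𝓝 0) := by
    refine squeeze_zero_norm (fun n => ?_) hconv
    exact norm_integral_le_of_norm_le ((hhn n).sub hh).abs (Eventually.of_forall fun x =>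
      abs_abs_add_mul_sub_abs_add_mul_div_le (θ x) (hn n x) (h x) (htpos n))
  have hsum := hdiff.add hfixed
  rw [zero_add] at hsum
  refine hsum.congr fun n => ?_
  rw [integral_div, integral_div, integral_sub (hint n (hhn n)) (hint n hh),
    integral_sub (hint n hh) hθ.abs]
  ring
end

section
/- Let (E, μ) be a σ-finite measure space and θ ∈ L¹(μ). The Hadamard directional derivative of the L¹-norm at θ, δ'_θ(h) = ∫_{{θ=0}} |h| dμ + ∫_{{θ≠0}} h·sgn(θ) dμ, is a linear functional of h ∈ L¹(μ) — equivalently, the L¹-norm is fully Hadamard differentiable at θ with derivative h ↦ ∫_E h·sgn(θ) dμ — if and only if μ({x : θ(x) = 0}) = 0. -/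
open MeasureTheory Filter Topology

theorem measurable_real_sign : Measurable Real.sign := by
  unfold Real.sign
  exact Measurable.ite measurableSet_Iio measurable_const
    (Measurable.ite measurableSet_Ioi measurable_const measurable_const)

theorem abs_real_sign_le_one (r : ℝ) : |Real.sign r| ≤ 1 := by
  rcases Real.sign_apply_eq r with h | h | h <;> simp [h]

theorem MeasureTheory.Integrable.mul_real_sign {E : Type*} [MeasurableSpace E] {μ : Measure E}
    {h θ : E → ℝ} (hh : Integrable h μ) (hmθ : Measurable θ) :
    Integrable (fun x => h x * Real.sign (θ x)) μ :=
  hh.mul_bdd (c := 1) (measurable_real_sign.comp hmθ).aestronglyMeasurable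
    (.of_forall fun x => abs_real_sign_le_one (θ x))

theorem setIntegral_ne_zero_mul_real_sign {E : Type*} [MeasurableSpace E] (μ : Measure E)
    (h θ : E → ℝ) :
    ∫ x in {x | θ x ≠ 0}, h x * Real.sign (θ x) ∂μ = ∫ x, h x * Real.sign (θ x) ∂μ := by
  refine setIntegral_eq_integral_of_forall_compl_eq_zero fun x hx => ?_
  have hx : θ x = 0 := by simpa using hx
  simp [hx]

/-- A set is null as soon as every integrable function has vanishing `L¹`-norm on it. -/
theorem measure_eq_zero_of_forall_setIntegral_abs_eq_zero {E : Type*} [MeasurableSpace E]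
    {μ : Measure E} [SigmaFinite μ] {s : Set E}
    (hs : ∀ h : E → ℝ, Integrable h μ → ∫ x in s, |h x| ∂μ = 0) : μ s = 0 := by
  obtain ⟨k, hk_pos, hk_meas, hk_lt⟩ := exists_pos_lintegral_lt_of_sigmaFinite μ one_ne_zero
  have hk : Integrable (fun x => (k x : ℝ)) μ := by
    refine ⟨hk_meas.coe_nnreal_real.aestronglyMeasurable, ?_⟩
    simpa [HasFiniteIntegral, enorm] using hk_lt.trans ENNReal.one_lt_top
  have h0 := (integral_eq_zero_iff_of_nonneg (fun x => abs_nonneg _) hk.abs.integrableOn).1 (hs _ hk)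
  rw [← Measure.restrict_eq_zero, ← ae_eq_bot, ← eventually_false_iff_eq_bot]
  filter_upwards [h0] with x hx
  exact (hk_pos x).ne' (by simpa using hx)

/-- **Linearity of the directional derivative of the L¹-norm ⟺ null contact set.**
For `θ ∈ L¹(μ)` on a σ-finite measure space, the Hadamard directional derivative
`δ'_θ(h) = ∫_{θ=0} |h| + ∫_{θ≠0} h·sgn(θ)` of the L¹-norm at `θ` is linear in `h` —
equivalently, it equals the full derivative `h ↦ ∫ h·sgn(θ)` — if and only if
`μ {θ = 0} = 0`. -/
theorem L1_norm_derivative_linear_iff_null_contact_set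
    {E : Type*} [MeasurableSpace E] (μ : Measure E) [SigmaFinite μ]
    (θ : E → ℝ) (hmθ : Measurable θ) (hθ : Integrable θ μ)
    (δ : (E → ℝ) → ℝ)
    (hδ : ∀ h : E → ℝ, δ h =
      (∫ x in {x | θ x = 0}, |h x| ∂μ) + ∫ x in {x | θ x ≠ 0}, h x * Real.sign (θ x) ∂μ) :
    (((∀ h g : E → ℝ, Integrable h μ → Integrable g μ → δ (h + g) = δ h + δ g) ∧
        (∀ (c : ℝ) (h : E → ℝ), Integrable h μ → δ (fun x => c * h x) = c * δ h)) ↔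
      μ {x | θ x = 0} = 0) ∧
    ((∀ h : E → ℝ, Integrable h μ → δ h = ∫ x, h x * Real.sign (θ x) ∂μ) ↔
      μ {x | θ x = 0} = 0) := by
  have hδ' (h : E → ℝ) : δ h =
      (∫ x in {x | θ x = 0}, |h x| ∂μ) + ∫ x, h x * Real.sign (θ x) ∂μ := by
    rw [hδ, setIntegral_ne_zero_mul_real_sign]
  have hnull (h0 : μ {x | θ x = 0} = 0) (h : E → ℝ) :
      δ h = ∫ x, h x * Real.sign (θ x) ∂μ := by
    rw [hδ', setIntegral_measure_zero _ h0, zero_add]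
  refine ⟨⟨fun ⟨_, hsmul⟩ => ?_, fun h0 => ⟨fun h g hh hg => ?_, fun c h _ => ?_⟩⟩,
    fun hfull => ?_, fun h0 h _ => hnull h0 h⟩
  · refine measure_eq_zero_of_forall_setIntegral_abs_eq_zero fun h hh => ?_
    have hneg := hsmul (-1) h hh
    simp only [hδ', neg_mul, one_mul, abs_neg, integral_neg] at hneg
    linarith
  · simp only [hnull h0, Pi.add_apply, add_mul]
    exact integral_add (hh.mul_real_sign hmθ) (hg.mul_real_sign hmθ)
  · simp only [hnull h0, mul_assoc, integral_const_mul]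
  · refine measure_eq_zero_of_forall_setIntegral_abs_eq_zero fun h hh => ?_
    linarith [hfull h hh, hδ' h]
end

section
/- Let D ⊆ ℝ be an interval, s1, s2 : D → ℝ with s1 − s2 ∈ L¹(D) and ∫_D |s1 − s2| dt > 0, and for j = 1,2 let (ŝ_{j,n_j}) be random functions with ‖ŝ_{j,n_j} − s_j‖_{L¹(D)} → 0 almost surely as n_j → ∞. Then the plug-in estimator of the minimum violation ratio, ε̂_0 = (1/2)·( 1 − (∫_D (ŝ_{1,n1} − ŝ_{2,n2}) dt)/(∫_D |ŝ_{1,n1} − ŝ_{2,n2}| dt) ), converges almost surely, as n1, n2 → ∞, to ε_0 = (1/2)·( 1 − (∫_D (s1 − s2) dt)/(∫_D |s1 − s2| dt) ). -/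
open MeasureTheory Filter Topology

/-- If `∫ |F i - f| → 0` then `∫ F i → ∫ f` and `∫ |F i| → ∫ |f|`. -/
lemma tendsto_integral_and_integral_abs_of_integral_abs_sub {α ι : Type*} [MeasurableSpace α]
    {μ : Measure α} {l : Filter ι} {F : ι → α → ℝ} {f : α → ℝ}
    (hF : ∀ i, Integrable (F i) μ) (hf : Integrable f μ)
    (h : Tendsto (fun i => ∫ x, |F i x - f x| ∂μ) l (𝓝 0)) :
    Tendsto (fun i => ∫ x, F i x ∂μ) l (𝓝 (∫ x, f x ∂μ)) ∧
      Tendsto (fun i => ∫ x, |F i x| ∂μ) l (𝓝 (∫ x, |f x| ∂μ)) := by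
  constructor <;> rw [tendsto_iff_norm_sub_tendsto_zero] <;>
    refine squeeze_zero (fun _ => norm_nonneg _) (fun i => ?_) h
  · rw [← integral_sub (hF i) hf]
    exact abs_integral_le_integral_abs
  · rw [← integral_sub (hF i).abs hf.abs]
    refine abs_integral_le_integral_abs.trans ?_
    exact integral_mono ((hF i).abs.sub hf.abs).abs ((hF i).sub hf).abs
      fun x => abs_abs_sub_abs_le_abs_sub (F i x) (f x)

/-- **Strong consistency of the plug-in estimator of the minimum violation ratio.**
If `‖Ŝ_{j,n_j} - s_j‖_{L¹(D)} → 0` almost surely, `j = 1, 2`, and `∫_D |s1 - s2| > 0`, then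
the plug-in MVR estimator
`ε̂₀ = (1/2)(1 - ∫_D (Ŝ₁ - Ŝ₂) / ∫_D |Ŝ₁ - Ŝ₂|)` converges almost surely to
`ε₀ = (1/2)(1 - ∫_D (s1 - s2) / ∫_D |s1 - s2|)` as `n₁, n₂ → ∞`. -/
theorem MVR_plugin_estimator_strong_consistency
    {Ω : Type*} [MeasurableSpace Ω] (P : Measure Ω) [IsProbabilityMeasure P]
    (D : Set ℝ) (hD : MeasurableSet D) (hDconn : D.OrdConnected)
    (s1 s2 : ℝ → ℝ) (hInt : IntegrableOn (fun t => s1 t - s2 t) D)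
    (hpos : 0 < ∫ t in D, |s1 t - s2 t|)
    (S1 S2 : ℕ → Ω → ℝ → ℝ)
    (hS1int : ∀ n ω, IntegrableOn (fun t => S1 n ω t - s1 t) D)
    (hS2int : ∀ n ω, IntegrableOn (fun t => S2 n ω t - s2 t) D)
    (hS1 : ∀ᵐ ω ∂P, Tendsto (fun n => ∫ t in D, |S1 n ω t - s1 t|) atTop (𝓝 0))
    (hS2 : ∀ᵐ ω ∂P, Tendsto (fun n => ∫ t in D, |S2 n ω t - s2 t|) atTop (𝓝 0)) :
    ∀ᵐ ω ∂P, Tendsto (fun p : ℕ × ℕ =>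
        (1 / 2) * (1 - (∫ t in D, (S1 p.1 ω t - S2 p.2 ω t)) /
          ∫ t in D, |S1 p.1 ω t - S2 p.2 ω t|))
      atTop (𝓝 ((1 / 2) * (1 - (∫ t in D, (s1 t - s2 t)) / ∫ t in D, |s1 t - s2 t|))) := by
  filter_upwards [hS1, hS2] with ω h1 h2
  have hF : ∀ p : ℕ × ℕ, IntegrableOn (fun t => S1 p.1 ω t - S2 p.2 ω t) D := fun p =>
    (((hS1int p.1 ω).sub (hS2int p.2 ω)).add hInt).congr <| .of_forall fun t => by
      simp only [Pi.add_apply, Pi.sub_apply]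
      ring
  have hsum : Tendsto (fun p : ℕ × ℕ =>
      (∫ t in D, |S1 p.1 ω t - s1 t|) + ∫ t in D, |S2 p.2 ω t - s2 t|) atTop (𝓝 0) := by
    rw [← prod_atTop_atTop_eq]
    simpa using (h1.comp tendsto_fst).add (h2.comp tendsto_snd)
  have hL1 : Tendsto (fun p : ℕ × ℕ =>
      ∫ t in D, |(S1 p.1 ω t - S2 p.2 ω t) - (s1 t - s2 t)|) atTop (𝓝 0) := by
    refine squeeze_zero (fun p => integral_nonneg fun t => abs_nonneg _) (fun p => ?_) hsum
    rw [← integral_add (hS1int p.1 ω).abs (hS2int p.2 ω).abs]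
    refine integral_mono ((hF p).sub hInt).abs
      ((hS1int p.1 ω).abs.add (hS2int p.2 ω).abs) fun t => ?_
    simpa only [sub_sub_sub_comm] using abs_sub (S1 p.1 ω t - s1 t) (S2 p.2 ω t - s2 t)
  obtain ⟨hnum, hden⟩ := tendsto_integral_and_integral_abs_of_integral_abs_sub hF hInt hL1
  exact ((hnum.div hden hpos.ne').const_sub 1).const_mul (1 / 2)
end
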